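/- Every finite-type-Dyck shift over a pushdown alphabet A is a sofic-Dyck shift over A. -/

import Mathlib

namespace SD

/-- The three kinds of letters of a pushdown alphabet. -/
inductive LetterKind : Type
  | call
  | ret
  | intern
  deriving DecidableEq

/-- A pushdown alphabet structure on `A`: a partition of the letters into
call letters, return letters and internal letters. -/
structure PushdownAlphabet (A : Type*) where
  kind : A → LetterKind

/-- Number of call letters of a word. -/
def callCount {A : Type*} (P : PushdownAlphabet A) (u : List A) : ℕ :=
  u.countP (fun a => decide (P.kind a = LetterKind.call))

/-- Number of return letters of a word. -/
def retCount {A : Type*} (P : PushdownAlphabet A) (u : List A) : ℕ :=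
  u.countP (fun a => decide (P.kind a = LetterKind.ret))

/-- A word is matched-return if every prefix has at least as many call letters
as return letters. -/
def MatchedReturn {A : Type*} (P : PushdownAlphabet A) (u : List A) : Prop :=
  ∀ v w : List A, u = v ++ w → retCount P v ≤ callCount P v

/-- A word is matched-call if every suffix has at least as many return letters
as call letters. -/
def MatchedCall {A : Type*} (P : PushdownAlphabet A) (u : List A) : Prop :=
  ∀ v w : List A, u = v ++ w → callCount P w ≤ retCount P w

/-- A Dyck word is a word which is both matched-return and matched-call. -/
def IsDyck {A : Type*} (P : PushdownAlphabet A) (u : List A) : Prop :=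
  MatchedReturn P u ∧ MatchedCall P u

/-- The factor of length `n` of a bi-infinite sequence starting at position `i`. -/
def factorAt {A : Type*} (x : ℤ → A) (i : ℤ) (n : ℕ) : List A :=
  (List.range n).map (fun k => x (i + (k : ℤ)))

/-- `w` is a (finite) factor of the bi-infinite sequence `x`. -/
def IsFactorOf {A : Type*} (w : List A) (x : ℤ → A) : Prop :=
  ∃ i : ℤ, w = factorAt x i w.length

/-- A Dyck automaton over alphabet `A` with states `Q`: a labeled graph together
with a set of matched pairs of edges. -/
structure DyckAutomaton (A : Type*) (Q : Type*) where
  edges : Set (Q × A × Q)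
  matched : Set ((Q × A × Q) × (Q × A × Q))

/-- Well-formedness of a Dyck automaton: matched pairs consist of edges of the
automaton, a call edge followed by a return edge. -/
def DyckAutomaton.WellFormed {A Q : Type*} (P : PushdownAlphabet A)
    (𝒜 : DyckAutomaton A Q) : Prop :=
  ∀ e f : Q × A × Q, (e, f) ∈ 𝒜.matched →
    e ∈ 𝒜.edges ∧ f ∈ 𝒜.edges ∧
    P.kind e.2.1 = LetterKind.call ∧ P.kind f.2.1 = LetterKind.ret

/-- The label of a finite path. -/
def pathLabel {A Q : Type*} (π : List (Q × A × Q)) : List A :=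
  π.map (fun e => e.2.1)

/-- A finite path of the underlying graph: a sequence of consecutive edges. -/
def IsPath {A Q : Type*} (𝒜 : DyckAutomaton A Q) (π : List (Q × A × Q)) : Prop :=
  (∀ e ∈ π, e ∈ 𝒜.edges) ∧ π.Chain' (fun e f => e.2.2 = f.1)

/-- A finite path is admissible if for any factor `e · π₁ · f` of it with `e` a call
edge, `f` a return edge and the label of `π₁` a Dyck word, `(e,f)` is a matched pair. -/
def IsAdmissible {A Q : Type*} (P : PushdownAlphabet A) (𝒜 : DyckAutomaton A Q)
    (π : List (Q × A × Q)) : Prop :=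
  IsPath 𝒜 π ∧
  ∀ (π₀ : List (Q × A × Q)) (e : Q × A × Q) (π₁ : List (Q × A × Q)) (f : Q × A × Q)
    (π₂ : List (Q × A × Q)), π = π₀ ++ e :: π₁ ++ f :: π₂ →
    P.kind e.2.1 = LetterKind.call → P.kind f.2.1 = LetterKind.ret →
    IsDyck P (pathLabel π₁) → (e, f) ∈ 𝒜.matched

/-- The finite factor of a bi-infinite path starting at index `i`, of length `n`. -/
def pathSeg {A Q : Type*} (π : ℤ → Q × A × Q) (i : ℤ) (n : ℕ) : List (Q × A × Q) :=
  (List.range n).map (fun k => π (i + (k : ℤ)))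

/-- A bi-infinite path is admissible if it is a bi-infinite path of the graph all of
whose finite factors are admissible. -/
def BiAdmissible {A Q : Type*} (P : PushdownAlphabet A) (𝒜 : DyckAutomaton A Q)
    (π : ℤ → Q × A × Q) : Prop :=
  (∀ i : ℤ, π i ∈ 𝒜.edges) ∧ (∀ i : ℤ, (π i).2.2 = (π (i + 1)).1) ∧
  ∀ (i : ℤ) (n : ℕ), IsAdmissible P 𝒜 (pathSeg π i n)

/-- The sofic-Dyck shift presented by a Dyck automaton: the set of labels of
bi-infinite admissible paths. -/
def presents {A Q : Type*} (P : PushdownAlphabet A) (𝒜 : DyckAutomaton A Q) :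
    Set (ℤ → A) :=
  { x | ∃ π : ℤ → Q × A × Q, BiAdmissible P 𝒜 π ∧ ∀ i : ℤ, (π i).2.1 = x i }

/-- A sofic-Dyck shift over `A`: a set presented by some (finite, well-formed)
Dyck automaton. -/
def IsSoficDyck {A : Type*} (P : PushdownAlphabet A) (X : Set (ℤ → A)) : Prop :=
  ∃ (N : ℕ) (𝒜 : DyckAutomaton A (Fin N)), 𝒜.WellFormed P ∧ X = presents P 𝒜

/-- A finite path goes from `p` to `q` (an empty path goes from `p` to `p`). -/
def GoesFromTo {A Q : Type*} (π : List (Q × A × Q)) (p q : Q) : Prop :=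
  (∀ e ∈ π.head?, e.1 = p) ∧ (∀ e ∈ π.getLast?, e.2.2 = q) ∧ (π = [] → p = q)

/-- A finite path starts at state `p`. -/
def StartsAt {A Q : Type*} (π : List (Q × A × Q)) (p : Q) : Prop :=
  ∀ e ∈ π.head?, e.1 = p

/-- A bi-infinite sequence avoids a set `F` of finite words if no finite factor of it
belongs to `F`. -/
def AvoidsWords {A : Type*} (F : Set (List A)) (x : ℤ → A) : Prop :=
  ∀ w : List A, IsFactorOf w x → w ∉ F

/-- A bi-infinite sequence avoids a set `U` of pairs `((u₁,a,u₂),(v₁,b,v₂))` if for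
every finite factor `v·a·w·b·z` of it with `a` call, `b` return and `w` a Dyck word,
no pair `((u₁,a,u₂),(v₁,b,v₂)) ∈ U` satisfies `(u₁,u₂) ⪯ (v, w·b·z)` and
`(v₁,v₂) ⪯ (v·a·w, z)`. -/
def AvoidsPairs {A : Type*} (P : PushdownAlphabet A)
    (U : Set ((List A × A × List A) × (List A × A × List A))) (x : ℤ → A) : Prop :=
  ∀ (v : List A) (a : A) (w : List A) (b : A) (z : List A),
    IsFactorOf (v ++ a :: w ++ b :: z) x →
    P.kind a = LetterKind.call → P.kind b = LetterKind.ret → IsDyck P w →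
    ∀ u₁ u₂ v₁ v₂ : List A, ((u₁, a, u₂), (v₁, b, v₂)) ∈ U →
      ¬(u₁ <:+ v ∧ u₂ <+: w ++ b :: z ∧ v₁ <:+ v ++ a :: w ∧ v₂ <+: z)

/-- A finite-type-Dyck shift over `A`: the set of bi-infinite sequences avoiding two
finite sets `F` and `U`. -/
def IsFiniteTypeDyck {A : Type*} (P : PushdownAlphabet A) (X : Set (ℤ → A)) : Prop :=
  ∃ (F : Set (List A)) (U : Set ((List A × A × List A) × (List A × A × List A))),
    F.Finite ∧ U.Finite ∧
    (∀ u ∈ U, P.kind u.1.2.1 = LetterKind.call ∧ P.kind u.2.2.1 = LetterKind.ret) ∧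
    X = { x | AvoidsWords F x ∧ AvoidsPairs P U x }

end SD

namespace SD

section Factors

variable {A : Type*}

theorem factorAt_eq_map (x : ℤ → A) (i : ℤ) (n : ℕ) :
    factorAt x i n = (List.range n).map fun k : ℕ => x (i + k) := by
  simp [factorAt, ← List.map_eq_flatMap, Function.comp_def]

@[simp]
theorem length_factorAt (x : ℤ → A) (i : ℤ) (n : ℕ) : (factorAt x i n).length = n := by
  simp [factorAt_eq_map]

theorem factorAt_succ (x : ℤ → A) (i : ℤ) (n : ℕ) :
    factorAt x i (n + 1) = x i :: factorAt x (i + 1) n := by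
  simp only [factorAt_eq_map, List.range_succ_eq_map, List.map_cons, List.map_map]
  congr 1
  · simp
  · refine List.map_congr_left fun k _ => ?_
    simp only [Function.comp]
    congr 1
    push_cast
    ring

theorem factorAt_add (x : ℤ → A) (i : ℤ) (m n : ℕ) :
    factorAt x i (m + n) = factorAt x i m ++ factorAt x (i + m) n := by
  induction m generalizing i with
  | zero => simp [factorAt]
  | succ m ih =>
    rw [Nat.add_right_comm, factorAt_succ, ih, factorAt_succ, List.cons_append]
    congr 3
    push_cast
    ring

theorem factorAt_congr {x y : ℤ → A} {i j : ℤ} {n : ℕ}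
    (h : ∀ k : ℕ, k < n → x (i + k) = y (j + k)) : factorAt x i n = factorAt y j n := by
  simp only [factorAt_eq_map]
  exact List.map_congr_left fun k hk => h k (List.mem_range.1 hk)

theorem append_eq_factorAt {x : ℤ → A} {i : ℤ} {n : ℕ} {u v : List A}
    (h : u ++ v = factorAt x i n) :
    u = factorAt x i u.length ∧ v = factorAt x (i + u.length) v.length := by
  have hn : n = u.length + v.length := by simpa using (congrArg List.length h).symm
  rw [hn, factorAt_add] at h
  exact List.append_inj h (by simp)

theorem cons_eq_factorAt {x : ℤ → A} {i : ℤ} {n : ℕ} {a : A} {v : List A}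
    (h : a :: v = factorAt x i n) : a = x i ∧ v = factorAt x (i + 1) v.length := by
  have hn : n = v.length + 1 := by simpa using (congrArg List.length h).symm
  rw [hn, factorAt_succ] at h
  exact List.cons_eq_cons.1 h

theorem eq_of_prefix_factorAt {x : ℤ → A} {i : ℤ} {n : ℕ} {u : List A}
    (h : u <+: factorAt x i n) : u = factorAt x i u.length := by
  obtain ⟨t, ht⟩ := h
  exact (append_eq_factorAt ht).1

theorem eq_of_suffix_factorAt {x : ℤ → A} {i : ℤ} {n : ℕ} {u : List A}
    (h : u <:+ factorAt x i n) : u = factorAt x (i + n - u.length) u.length := by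
  obtain ⟨t, ht⟩ := h
  have hn : t.length + u.length = n := by simpa using congrArg List.length ht
  have h2 := (append_eq_factorAt ht).2
  rwa [show i + (n : ℤ) - u.length = i + t.length by omega]

theorem factorAt_isPrefix_factorAt (x : ℤ → A) (i : ℤ) {m n : ℕ} (h : m ≤ n) :
    factorAt x i m <+: factorAt x i n := by
  obtain ⟨k, rfl⟩ := Nat.exists_eq_add_of_le h
  exact ⟨_, (factorAt_add x i m k).symm⟩

theorem factorAt_isSuffix_factorAt (x : ℤ → A) (i : ℤ) {m n : ℕ} (h : m ≤ n) :
    factorAt x (i + n - m) m <:+ factorAt x i n := by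
  obtain ⟨k, rfl⟩ := Nat.exists_eq_add_of_le' h
  refine ⟨factorAt x i k, ?_⟩
  rw [factorAt_add]
  congr 2
  push_cast
  ring

/-- Reading off positions from a decomposition of a factor around two letters. -/
theorem decomp_eq_factorAt {x : ℤ → A} {i : ℤ} {n : ℕ} {v w z : List A} {a b : A}
    (h : v ++ a :: w ++ b :: z = factorAt x i n) :
    v = factorAt x i v.length ∧ a = x (i + v.length) ∧
      w = factorAt x (i + v.length + 1) w.length ∧
      b = x (i + v.length + 1 + w.length) ∧
      z = factorAt x (i + v.length + 1 + w.length + 1) z.length := by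
  rw [List.append_assoc] at h
  obtain ⟨hv, h⟩ := append_eq_factorAt h
  obtain ⟨ha, h⟩ := cons_eq_factorAt h
  obtain ⟨hw, h⟩ := append_eq_factorAt h
  obtain ⟨hb, hz⟩ := cons_eq_factorAt h
  exact ⟨hv, ha, hw, hb, hz⟩

theorem factorAt_decomp (x : ℤ → A) (i : ℤ) (l n r : ℕ) :
    factorAt x i (l + (n + (r + 1) + 1)) =
      factorAt x i l ++ x (i + l) :: factorAt x (i + l + 1) n ++
        x (i + l + 1 + n) :: factorAt x (i + l + 1 + n + 1) r := by
  rw [factorAt_add, factorAt_succ, factorAt_add, factorAt_succ, List.append_assoc,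
    List.cons_append]

theorem isChain_factorAt {x : ℤ → A} {R : A → A → Prop} (h : ∀ i, R (x i) (x (i + 1)))
    (i : ℤ) (n : ℕ) : (factorAt x i n).IsChain R := by
  induction n generalizing i with
  | zero => simp [factorAt]
  | succ n ih =>
    rw [factorAt_succ, List.isChain_cons]
    refine ⟨?_, ih _⟩
    cases n with
    | zero => simp [factorAt]
    | succ n =>
      rw [factorAt_succ]
      simpa using h i

end Factors

section Local

variable {A : Type*}

/-- The letter at position `i` of `x` is `u.2.1`, preceded by `u.1` and followed by `u.2.2`. -/
def OccursAround (x : ℤ → A) (i : ℤ) (u : List A × A × List A) : Prop :=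
  x i = u.2.1 ∧ u.1 = factorAt x (i - u.1.length) u.1.length ∧
    u.2.2 = factorAt x (i + 1) u.2.2.length

theorem OccursAround.congr {x y : ℤ → A} {i j : ℤ} {m : ℕ} {u : List A × A × List A}
    (hxy : ∀ k : ℤ, -m ≤ k → k ≤ m → x (i + k) = y (j + k))
    (h₁ : u.1.length ≤ m) (h₂ : u.2.2.length ≤ m) (h : OccursAround x i u) :
    OccursAround y j u := by
  obtain ⟨ha, hl, hr⟩ := h
  refine ⟨?_, hl.trans (factorAt_congr fun k hk => ?_), hr.trans (factorAt_congr fun k hk => ?_)⟩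
  · rw [← ha]
    simpa using (hxy 0 (by omega) (by omega)).symm
  · convert hxy (k - u.1.length) (by omega) (by omega) using 2 <;> ring
  · convert hxy (1 + k) (by omega) (by omega) using 2 <;> ring

/-- Positions `i` and `i + 1 + n` of `x` carry a call and the return matching it. -/
def MatchedAt (P : PushdownAlphabet A) (x : ℤ → A) (i : ℤ) (n : ℕ) : Prop :=
  P.kind (x i) = LetterKind.call ∧ P.kind (x (i + 1 + n)) = LetterKind.ret ∧
    IsDyck P (factorAt x (i + 1) n)

theorem avoidsWords_iff {F : Set (List A)} {x : ℤ → A} :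
    AvoidsWords F x ↔ ∀ w ∈ F, ∀ i, w ≠ factorAt x i w.length :=
  ⟨fun h w hw i e => h w ⟨i, e⟩ hw, fun h w ⟨i, e⟩ hw => h w hw i e⟩

theorem avoidsPairs_iff {P : PushdownAlphabet A}
    {U : Set ((List A × A × List A) × (List A × A × List A))} {x : ℤ → A} :
    AvoidsPairs P U x ↔ ∀ i n, MatchedAt P x i n → ∀ u ∈ U,
      ¬(OccursAround x i u.1 ∧ OccursAround x (i + 1 + n) u.2) := by
  constructor
  · rintro h i n ⟨hc, hr, hw⟩ ⟨⟨u₁, a, u₂⟩, v₁, b, v₂⟩ hu ⟨⟨ha, hu₁, hu₂⟩, hb, hv₁, hv₂⟩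
    dsimp only at *
    obtain ⟨L, hL⟩ : ∃ L, L = u₁.length + u₂.length + v₁.length + v₂.length := ⟨_, rfl⟩
    have hdec := factorAt_decomp x (i - L) L n L
    simp only [sub_add_cancel] at hdec
    refine h (factorAt x (i - L) L) (x i) (factorAt x (i + 1) n) (x (i + 1 + n))
      (factorAt x (i + 1 + n + 1) L) ⟨i - L, ?_⟩ hc hr hw u₁ u₂ v₁ v₂
      (by rwa [ha, hb]) ⟨?_, ?_, ?_, ?_⟩
    · rw [← hdec, length_factorAt]
    · have := factorAt_isSuffix_factorAt x (i - L) (show u₁.length ≤ L by omega)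
      rwa [sub_add_cancel, ← hu₁] at this
    · rw [← factorAt_succ, ← factorAt_add, hu₂]
      simpa using factorAt_isPrefix_factorAt x (i + 1) (by omega)
    · have h1 : factorAt x (i - L) L ++ x i :: factorAt x (i + 1) n
          = factorAt x (i - L) (L + (n + 1)) := by
        rw [factorAt_add, factorAt_succ, sub_add_cancel]
      have h2 := factorAt_isSuffix_factorAt x (i - L) (show v₁.length ≤ L + (n + 1) by omega)
      rw [h1]
      rw [show i - L + (L + (n + 1) : ℕ) - v₁.length = i + 1 + n - v₁.length by push_cast; ring,
        ← hv₁] at h2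
      exact h2
    · rw [hv₂]
      simpa using factorAt_isPrefix_factorAt x (i + 1 + n + 1) (show v₂.length ≤ L by omega)
  · rintro h v a w b z ⟨i, hx⟩ hc hr hd u₁ u₂ v₁ v₂ hu ⟨h1, h2, h3, h4⟩
    obtain ⟨hv, ha, hw, hb, hz⟩ := decomp_eq_factorAt hx
    refine h (i + v.length) w.length ⟨ha ▸ hc, hb ▸ hr, hw ▸ hd⟩ _ hu
      ⟨⟨ha.symm, ?_, ?_⟩, hb.symm, ?_, ?_⟩
    · rw [hv] at h1
      exact eq_of_suffix_factorAt h1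
    · rw [List.append_assoc] at hx
      have : w ++ b :: z = factorAt x (i + v.length + 1) (w ++ b :: z).length :=
        (cons_eq_factorAt (append_eq_factorAt hx).2).2
      rw [this] at h2
      exact eq_of_prefix_factorAt h2
    · rw [(append_eq_factorAt hx).1] at h3
      have := eq_of_suffix_factorAt h3
      rwa [show i + ((v ++ a :: w).length : ℤ) - v₁.length
        = i + v.length + 1 + w.length - v₁.length by simp; ring] at this
    · rw [hz] at h4
      exact eq_of_prefix_factorAt h4

theorem biAdmissible_iff {Q : Type*} {P : PushdownAlphabet A} {𝒜 : DyckAutomaton A Q}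
    {π : ℤ → Q × A × Q} :
    BiAdmissible P 𝒜 π ↔ (∀ i, π i ∈ 𝒜.edges) ∧ (∀ i, (π i).2.2 = (π (i + 1)).1) ∧
      ∀ i n, MatchedAt P (fun k => (π k).2.1) i n → (π i, π (i + 1 + n)) ∈ 𝒜.matched := by
  have hlabel : ∀ i n, pathLabel (factorAt π i n) = factorAt (fun k => (π k).2.1) i n := by
    intro i n
    simp [pathLabel, factorAt_eq_map]
  refine and_congr_right fun hE => and_congr_right fun hC => ⟨?_, ?_⟩
  · rintro h i n ⟨hc, hr, hd⟩
    refine (h i (0 + (n + (0 + 1) + 1))).2 [] (π i) (factorAt π (i + 1) n) (π (i + 1 + n)) []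
      ?_ hc hr (by rwa [hlabel])
    have := factorAt_decomp π i 0 n 0
    simpa [factorAt, pathSeg] using this
  · intro h i n
    refine ⟨⟨fun e he => ?_, isChain_factorAt hC i n⟩, ?_⟩
    · change e ∈ factorAt π i n at he
      rw [factorAt_eq_map] at he
      obtain ⟨k, -, rfl⟩ := List.mem_map.1 he
      exact hE _
    · intro π₀ e π₁ f π₂ heq hc hr hd
      obtain ⟨-, he, h1, hf, -⟩ := decomp_eq_factorAt (x := π) heq.symm
      rw [h1, hlabel] at hd
      rw [he] at hc ⊢
      rw [hf] at hr ⊢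
      exact h _ _ ⟨hc, hr, hd⟩

/-- The windows of radius `m` of bi-infinite sequences can be encoded by finitely many codes. -/
theorem exists_window_code [Finite A] (m : ℕ) :
    ∃ (N : ℕ) (W : (ℤ → A) → ℤ → Fin N), ∀ x y i j,
      W x i = W y j ↔ ∀ k : ℤ, -m ≤ k → k ≤ m → x (i + k) = y (j + k) := by
  refine ⟨_, fun x i => Finite.equivFin (Set.Icc (-m : ℤ) m → A) fun k => x (i + k),
    fun x y i j => ?_⟩
  rw [EmbeddingLike.apply_eq_iff_eq, funext_iff]
  exact ⟨fun h k h1 h2 => h ⟨k, h1, h2⟩, fun h k => h k k.2.1 k.2.2⟩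

end Local

section Automaton

variable {A Q : Type*}

/-- The automaton on window codes: an edge shifts the window by one position and checks `F`,
and a pair of edges is matched when the windows of their sources do not contain a pair of `U`. -/
def windowAutomaton (P : PushdownAlphabet A) (F : Set (List A))
    (U : Set ((List A × A × List A) × (List A × A × List A))) (W : (ℤ → A) → ℤ → Q) :
    DyckAutomaton A Q where
  edges := {e | ∃ y, e = (W y 0, y 0, W y 1) ∧ ∀ w ∈ F, w ≠ factorAt y 0 w.length}
  matched := {p | ∃ y z, p = ((W y 0, y 0, W y 1), (W z 0, z 0, W z 1)) ∧
    (∀ w ∈ F, w ≠ factorAt y 0 w.length) ∧ (∀ w ∈ F, w ≠ factorAt z 0 w.length) ∧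
    P.kind (y 0) = LetterKind.call ∧ P.kind (z 0) = LetterKind.ret ∧
    ∀ u ∈ U, ¬(OccursAround y 0 u.1 ∧ OccursAround z 0 u.2)}

theorem windowAutomaton_wellFormed (P : PushdownAlphabet A) (F : Set (List A))
    (U : Set ((List A × A × List A) × (List A × A × List A))) (W : (ℤ → A) → ℤ → Q) :
    (windowAutomaton P F U W).WellFormed P := by
  rintro e f ⟨y, z, h, hy, hz, hc, hr, -⟩
  obtain ⟨rfl, rfl⟩ := Prod.mk.inj h
  exact ⟨⟨y, rfl, hy⟩, ⟨z, rfl, hz⟩, hc, hr⟩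

/-- Sequences whose radius `m` windows overlap consistently glue to the sequence of their
central letters. -/
theorem eq_central_of_overlap {m : ℕ} {y : ℤ → ℤ → A}
    (h : ∀ i k : ℤ, -m ≤ k → k ≤ m → y i (1 + k) = y (i + 1) (0 + k)) (i k : ℤ)
    (h₁ : -m ≤ k) (h₂ : k ≤ m) : y i k = y (i + k) 0 := by
  have pos : ∀ (n : ℕ) (i : ℤ), n ≤ m → y i n = y (i + n) 0 := by
    intro n
    induction n with
    | zero => simp
    | succ n ih =>
      intro i hn
      have := h i n (by omega) (by omega)
      rw [zero_add, ih _ (by omega)] at this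
      push_cast
      rw [add_comm (n : ℤ) 1, this, add_assoc]
  have neg : ∀ (n : ℕ) (i : ℤ), n ≤ m → y i (-n) = y (i + -n) 0 := by
    intro n
    induction n with
    | zero => simp
    | succ n ih =>
      intro i hn
      have := h (i - 1) (-(n + 1 : ℕ)) (by omega) (by omega)
      rw [zero_add, sub_add_cancel, show (1 : ℤ) + -(n + 1 : ℕ) = -n by push_cast; ring,
        ih _ (by omega)] at this
      rw [← this]
      congr 1
      push_cast
      ring
  obtain ⟨n, rfl | rfl⟩ := k.eq_nat_or_neg
  · exact pos n i (by omega)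
  · exact neg n i (by omega)

theorem presents_windowAutomaton {P : PushdownAlphabet A} {F : Set (List A)}
    {U : Set ((List A × A × List A) × (List A × A × List A))} {W : (ℤ → A) → ℤ → Q} {m : ℕ}
    (hW : ∀ x y i j,
      W x i = W y j ↔ ∀ k : ℤ, -m ≤ k → k ≤ m → x (i + k) = y (j + k))
    (hF : ∀ w ∈ F, w.length ≤ m)
    (hU : ∀ u ∈ U, (u.1.1.length ≤ m ∧ u.1.2.2.length ≤ m) ∧
      (u.2.1.length ≤ m ∧ u.2.2.2.length ≤ m)) :
    presents P (windowAutomaton P F U W) = {x | AvoidsWords F x ∧ AvoidsPairs P U x} := by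
  ext x
  simp only [presents, biAdmissible_iff, avoidsWords_iff, avoidsPairs_iff, Set.mem_ofPred_eq]
  constructor
  · rintro ⟨π, ⟨hE, hC, hM⟩, hx⟩
    obtain rfl : (fun i => (π i).2.1) = x := funext hx
    choose y hy hyF using hE
    have hov := fun i => (hW _ _ _ _).1 (by simpa [hy] using hC i : W (y i) 1 = W (y (i + 1)) 0)
    have hglue : ∀ i k : ℤ, -m ≤ k → k ≤ m → (π (i + k)).2.1 = y i (0 + k) := by
      intro i k h1 h2
      rw [zero_add, eq_central_of_overlap hov i k h1 h2, hy]
    refine ⟨fun w hw i e => hyF i w hw (e.trans (factorAt_congr fun k hk => ?_)), ?_⟩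
    · exact hglue i k (by omega) (by have := hF w hw; omega)
    · rintro i n hmat u hu ⟨o1, o2⟩
      obtain ⟨y', z', h, -, -, -, -, hn⟩ := hM i n hmat
      obtain ⟨e1, e2⟩ := Prod.mk.inj h
      rw [hy] at e1 e2
      have hu' := hU u hu
      exact hn u hu
        ⟨(o1.congr (hglue i) hu'.1.1 hu'.1.2).congr
            ((hW _ _ _ _).1 (Prod.mk.inj e1).1) hu'.1.1 hu'.1.2,
          (o2.congr (hglue _) hu'.2.1 hu'.2.2).congr
            ((hW _ _ _ _).1 (Prod.mk.inj e2).1) hu'.2.1 hu'.2.2⟩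
  · rintro ⟨hxF, hxU⟩
    have hshift : ∀ i j, W x (i + j) = W (fun k => x (i + k)) j :=
      fun i j => (hW _ _ _ _).2 fun k _ _ => by rw [add_assoc]
    have hedge : ∀ i, (W x i, x i, W x (i + 1)) = (W (fun k => x (i + k)) 0, x (i + 0),
        W (fun k => x (i + k)) 1) := by
      intro i
      rw [← hshift, ← hshift, add_zero]
    have hword : ∀ i, ∀ w ∈ F, w ≠ factorAt (fun k => x (i + k)) 0 w.length := by
      intro i w hw e
      exact hxF w hw i (e.trans (factorAt_congr fun k _ => by rw [zero_add]))
    refine ⟨fun i => (W x i, x i, W x (i + 1)),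
      ⟨fun i => ⟨_, hedge i, hword i⟩, fun i => rfl, fun i n hmat => ?_⟩, fun i => rfl⟩
    refine ⟨_, _, Prod.ext (hedge i) (hedge (i + 1 + n)), hword i, hword _, ?_, ?_, ?_⟩
    · simpa using hmat.1
    · simpa using hmat.2.1
    · rintro u hu ⟨o1, o2⟩
      have hu' := hU u hu
      exact hxU i n hmat u hu
        ⟨o1.congr (fun k _ _ => by rw [zero_add]) hu'.1.1 hu'.1.2,
          o2.congr (fun k _ _ => by rw [zero_add]) hu'.2.1 hu'.2.2⟩

end Automaton

end SD

open SD

/-- Every finite-type-Dyck shift is a sofic-Dyck shift. -/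
theorem statement_2 {A : Type*} [Fintype A] (P : PushdownAlphabet A)
    (X : Set (ℤ → A)) (hX : IsFiniteTypeDyck P X) : IsSoficDyck P X := by
  obtain ⟨F, U, hF, hU, -, rfl⟩ := hX
  obtain ⟨m₁, hm₁⟩ := (hF.image List.length).bddAbove
  obtain ⟨m₂, hm₂⟩ := (hU.image fun u =>
    u.1.1.length + u.1.2.2.length + (u.2.1.length + u.2.2.2.length)).bddAbove
  obtain ⟨N, W, hW⟩ := exists_window_code (A := A) (m₁ + m₂)
  refine ⟨N, windowAutomaton P F U W, windowAutomaton_wellFormed P F U W,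
    (presents_windowAutomaton hW (fun w hw => ?_) fun u hu => ?_).symm⟩
  · have := hm₁ (Set.mem_image_of_mem _ hw)
    omega
  · have := hm₂ (Set.mem_image_of_mem _ hu)
    omega
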